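/- Let A be a finite-dimensional vector space over a field F of characteristic 0 and Δ≺, Δ≻ : A → A⊗A two linear maps. Define bilinear products on A* by ⟨a ≺ b, x⟩ := ⟨a⊗b, Δ≺(x)⟩ and ⟨a ≻ b, x⟩ := ⟨a⊗b, Δ≻(x)⟩ for a,b ∈ A*, x ∈ A. Then (A*, ≺, ≻) is a pre-anti-flexible algebra if and only if, as maps A → A⊗A⊗A: (Δ≻⊗id)∘Δ≺ − (id⊗Δ≺)∘Δ≻ = (id⊗(σ∘Δ≻))∘σ∘Δ≺ − ((σ∘Δ≺)⊗id)∘σ∘Δ≻ and ((Δ≺+Δ≻)⊗id)∘Δ≻ − (id⊗Δ≻)∘Δ≻ = (id⊗(σ∘Δ≺))∘σ∘Δ≺ − ((σ∘(Δ≺+Δ≻))⊗id)∘σ∘Δ≺, where σ is the flip on A⊗A. -/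

import Mathlib

open TensorProduct

/-- Pre-anti-flexible algebra structure on a pair of bilinear products `(≺, ≻) = (p, s)`. -/
def IsPreAntiFlexible {F A : Type*} [Field F] [AddCommGroup A] [Module F A]
    (p s : A →ₗ[F] A →ₗ[F] A) : Prop :=
  (∀ x y z : A, p (s x y) z - s x (p y z) = p (s z y) x - s z (p y x)) ∧
  (∀ x y z : A, s (p x y + s x y) z - s x (s y z) = p (p z y) x - p z (p y x + s y x))

/-- The product on `A*` induced by a comultiplication `Δ : A → A ⊗ A`:
`⟨a · b, x⟩ = ⟨a ⊗ b, Δ(x)⟩`. -/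
noncomputable def dualProd {F A : Type*} [Field F] [AddCommGroup A] [Module F A]
    (Δ : A →ₗ[F] A ⊗[F] A) :
    Module.Dual F A →ₗ[F] Module.Dual F A →ₗ[F] Module.Dual F A :=
  (TensorProduct.mk F (Module.Dual F A) (Module.Dual F A)).compr₂
    (Δ.dualMap ∘ₗ TensorProduct.dualDistrib F A A)

/-- The flip `σ` on `A ⊗ A`. -/
noncomputable def sigmaTensor (F A : Type*) [Field F] [AddCommGroup A] [Module F A] :
    A ⊗[F] A →ₗ[F] A ⊗[F] A := (TensorProduct.comm F A A).toLinearMap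

theorem dualProd_apply {F A : Type*} [Field F] [AddCommGroup A] [Module F A]
    (Δ : A →ₗ[F] A ⊗[F] A) (a b : Module.Dual F A) :
    dualProd Δ a b = dualDistrib F A A (a ⊗ₜ b) ∘ₗ Δ := rfl

theorem dualProd_add {F A : Type*} [Field F] [AddCommGroup A] [Module F A]
    (Δ Δ' : A →ₗ[F] A ⊗[F] A) (a b : Module.Dual F A) :
    dualProd (Δ + Δ') a b = dualProd Δ a b + dualProd Δ' a b := by
  simp only [dualProd_apply, LinearMap.comp_add]

theorem dualDistrib_sigmaTensor {F A : Type*} [Field F] [AddCommGroup A] [Module F A]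
    (a b : Module.Dual F A) (t : A ⊗[F] A) :
    dualDistrib F A A (a ⊗ₜ b) (sigmaTensor F A t) = dualDistrib F A A (b ⊗ₜ a) t := by
  induction t with
  | zero => simp
  | tmul x y => simp [sigmaTensor, mul_comm]
  | add x y hx hy => simp only [map_add, hx, hy]

theorem dualProd_sigmaTensor_comp {F A : Type*} [Field F] [AddCommGroup A] [Module F A]
    (Δ : A →ₗ[F] A ⊗[F] A) (a b : Module.Dual F A) :
    dualProd (sigmaTensor F A ∘ₗ Δ) a b = dualProd Δ b a :=
  LinearMap.ext fun x => dualDistrib_sigmaTensor a b (Δ x)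

/-- The functional `a ⊗ b ⊗ c` on `A ⊗ (A ⊗ A)`. -/
noncomputable def tripleDual {F A : Type*} [Field F] [AddCommGroup A] [Module F A]
    (a b c : Module.Dual F A) : Module.Dual F (A ⊗[F] (A ⊗[F] A)) :=
  dualDistrib F A (A ⊗[F] A) (a ⊗ₜ dualDistrib F A A (b ⊗ₜ c))

theorem tripleDual_map_id {F A : Type*} [Field F] [AddCommGroup A] [Module F A]
    (Δ : A →ₗ[F] A ⊗[F] A) (a b c : Module.Dual F A) (t : A ⊗[F] A) :
    tripleDual a b c (TensorProduct.map LinearMap.id Δ t) =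
      dualDistrib F A A (a ⊗ₜ dualProd Δ b c) t := by
  induction t with
  | zero => simp
  | tmul x y => simp [tripleDual, dualProd_apply]
  | add x y hx hy => simp only [map_add, hx, hy]

theorem tripleDual_assoc_tmul {F A : Type*} [Field F] [AddCommGroup A] [Module F A]
    (a b c : Module.Dual F A) (t : A ⊗[F] A) (y : A) :
    tripleDual a b c (TensorProduct.assoc F A A A (t ⊗ₜ y)) =
      dualDistrib F A A (a ⊗ₜ b) t * c y := by
  induction t with
  | zero => simp
  | tmul u v => simp [tripleDual, mul_assoc]
  | add u v hu hv => simp only [map_add, TensorProduct.add_tmul, hu, hv, add_mul]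

theorem tripleDual_assoc_map {F A : Type*} [Field F] [AddCommGroup A] [Module F A]
    (Δ : A →ₗ[F] A ⊗[F] A) (a b c : Module.Dual F A) (t : A ⊗[F] A) :
    tripleDual a b c (TensorProduct.assoc F A A A (TensorProduct.map Δ LinearMap.id t)) =
      dualDistrib F A A (dualProd Δ a b ⊗ₜ c) t := by
  induction t with
  | zero => simp
  | tmul x y => simp [tripleDual_assoc_tmul, dualProd_apply]
  | add x y hx hy => simp only [map_add, hx, hy]

/-- The functionals `a ⊗ b ⊗ c` separate the points of `A ⊗ (A ⊗ A)`. -/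
theorem eq_iff_forall_tripleDual {F A M : Type*} [Field F] [AddCommGroup A] [Module F A]
    [FiniteDimensional F A] [AddCommGroup M] [Module F M] (f g : M →ₗ[F] A ⊗[F] (A ⊗[F] A)) :
    f = g ↔ ∀ a b c : Module.Dual F A, tripleDual a b c ∘ₗ f = tripleDual a b c ∘ₗ g := by
  refine ⟨fun h _ _ _ => h ▸ rfl, fun h => LinearMap.ext fun x => ?_⟩
  rw [← sub_eq_zero, ← Module.forall_dual_apply_eq_zero_iff F]
  intro φ
  obtain ⟨u, rfl⟩ := (dualDistribEquiv F A (A ⊗[F] A)).surjective φ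
  induction u with
  | zero => simp
  | add u v hu hv => simp only [map_add, LinearMap.add_apply, hu, hv, add_zero]
  | tmul a ψ =>
    obtain ⟨v, rfl⟩ := (dualDistribEquiv F A A).surjective ψ
    induction v with
    | zero => simp
    | add u v hu hv =>
      simp only [map_add, TensorProduct.tmul_add, LinearMap.add_apply, hu, hv, add_zero]
    | tmul b c =>
      have hx := LinearMap.congr_fun (h a b c) x
      rw [map_sub, sub_eq_zero]
      exact hx

/-- the dual products of `Δ≺, Δ≻` make `A*` a pre-anti-flexible algebra iff
the two coassociativity-type identities hold (with the canonical identification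
`(A⊗A)⊗A ≅ A⊗(A⊗A)`). -/
theorem dualProd_preAntiFlexible_iff
    {F A : Type*} [Field F] [CharZero F] [AddCommGroup A] [Module F A]
    [FiniteDimensional F A] (Δp Δs : A →ₗ[F] A ⊗[F] A) :
    IsPreAntiFlexible (dualProd Δp) (dualProd Δs) ↔
      (((TensorProduct.assoc F A A A).toLinearMap
            ∘ₗ TensorProduct.map Δs LinearMap.id ∘ₗ Δp)
          - TensorProduct.map LinearMap.id Δp ∘ₗ Δs
        = TensorProduct.map LinearMap.id (sigmaTensor F A ∘ₗ Δs) ∘ₗ sigmaTensor F A ∘ₗ Δp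
          - (TensorProduct.assoc F A A A).toLinearMap
              ∘ₗ TensorProduct.map (sigmaTensor F A ∘ₗ Δp) LinearMap.id
              ∘ₗ sigmaTensor F A ∘ₗ Δs) ∧
      (((TensorProduct.assoc F A A A).toLinearMap
            ∘ₗ TensorProduct.map (Δp + Δs) LinearMap.id ∘ₗ Δs)
          - TensorProduct.map LinearMap.id Δs ∘ₗ Δs
        = TensorProduct.map LinearMap.id (sigmaTensor F A ∘ₗ Δp) ∘ₗ sigmaTensor F A ∘ₗ Δp
          - (TensorProduct.assoc F A A A).toLinearMap
              ∘ₗ TensorProduct.map (sigmaTensor F A ∘ₗ (Δp + Δs)) LinearMap.id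
              ∘ₗ sigmaTensor F A ∘ₗ Δp) := by
  rw [eq_iff_forall_tripleDual, eq_iff_forall_tripleDual, IsPreAntiFlexible]
  refine and_congr ?_ ?_ <;>
  · refine forall_congr' fun a => forall_congr' fun b => forall_congr' fun c => Eq.congr ?_ ?_ <;>
    · ext x
      simp only [← dualProd_add, LinearMap.comp_apply, LinearMap.sub_apply, map_sub,
        LinearEquiv.coe_coe, tripleDual_map_id, tripleDual_assoc_map, dualDistrib_sigmaTensor,
        dualProd_sigmaTensor_comp]
      rfl
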